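/- Let D = (d, T) with d = (d_1, …, d_n), M = Σ_i d_i even, and T ≥ 1, and sample a temporal configuration of D uniformly at random. For every simple temporal graph G matching D, the probability that the corresponding temporal multigraph equals G is exactly (∏_{i=1}^n d_i!) · 2^{M/2} · (M/2)! / (M! · T^{M/2}). In particular, conditioned on the corresponding temporal multigraph being simple, it is uniformly distributed on the set G(D) of simple temporal graphs matching D. -/

import Mathlib

/-- The set `P` of labeled points: cell `P i` consists of `d i` points. -/
abbrev TPoint (n : ℕ) (d : Fin n → ℕ) : Type := (i : Fin n) × Fin (d i)

/-- A temporal configuration of `(d, T)`: a partition of the points into pairs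
(encoded as a fixed-point-free involution `pair`) together with a timestamp in `[1, T]`
(encoded as `Fin T`) assigned to each pair (encoded as a function on points that is
constant on each matched pair). -/
structure TConfig (n : ℕ) (d : Fin n → ℕ) (T : ℕ) where
  pair : TPoint n d → TPoint n d
  stamp : TPoint n d → Fin T
  invol : Function.Involutive pair
  nofix : ∀ x, pair x ≠ x
  compat : ∀ x, stamp (pair x) = stamp x
/-- The temporal multiplicity of the edge `({v i, v j}, t)` in the temporal multigraph
corresponding to a temporal configuration: for `i ≠ j`, each matched pair with one point in
cell `i` and one in cell `j` and timestamp `t` is witnessed by exactly one point `x` with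
`x.1 = i`; a loop at `i` is witnessed by two such points, whence the division by `2`. -/
noncomputable def configGraph {n T : ℕ} {d : Fin n → ℕ} (c : TConfig n d T)
    (i j : Fin n) (t : Fin T) : ℕ :=
  if i = j then
    Nat.card {x : TPoint n d // x.1 = i ∧ (c.pair x).1 = i ∧ c.stamp x = t} / 2
  else
    Nat.card {x : TPoint n d // x.1 = i ∧ (c.pair x).1 = j ∧ c.stamp x = t}

/-- The degree of node `i` in the temporal multigraph given by a symmetric temporal
multiplicity function `w` (a loop contributes `2` to the degree). -/
def tmDegree {n T : ℕ} (w : Fin n → Fin n → Fin T → ℕ) (i : Fin n) : ℕ :=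
  (∑ j, ∑ t, w i j t) + ∑ t, w i i t

open Equiv in
/-- A permutation of a set of `2 * k` elements is a fixed-point-free involution iff all its
cycles have length two. -/
theorem cycleType_eq_replicate_two_iff {α : Type*} [Fintype α] [DecidableEq α] {k : ℕ}
    (hα : Fintype.card α = 2 * k) (σ : Perm α) :
    σ.cycleType = Multiset.replicate k 2 ↔ Function.Involutive σ ∧ ∀ x, σ x ≠ x := by
  have hinv : Function.Involutive σ ↔ σ ^ 2 = 1 := by
    simp [Function.Involutive, Equiv.ext_iff, pow_two]
  have hfix : (∀ x, σ x ≠ x) ↔ σ.cycleType.sum = 2 * k := by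
    rw [Perm.sum_cycleType, ← hα, Finset.card_eq_iff_eq_univ, Finset.eq_univ_iff_forall]
    simp
  rw [hinv, hfix, Perm.pow_prime_eq_one_iff]
  constructor
  · intro h
    rw [h]
    exact ⟨fun c hc => Multiset.eq_of_mem_replicate hc, by simp [mul_comm]⟩
  · rintro ⟨h, hs⟩
    have h' := Multiset.eq_replicate.mpr ⟨rfl, h⟩
    rw [h'] at hs ⊢
    simp only [Multiset.sum_replicate, smul_eq_mul] at hs
    congr 1
    omega

/-- The number of perfect matchings of `2 * k` points is `(2 * k)! / (2 ^ k * k!)`. -/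
theorem card_fixedPointFree_involutions {α : Type*} [Fintype α] {k : ℕ}
    (hα : Fintype.card α = 2 * k) :
    Nat.card {f : α → α // Function.Involutive f ∧ ∀ x, f x ≠ x} * (2 ^ k * k.factorial) =
      (2 * k).factorial := by
  classical
  have e : {f : α → α // Function.Involutive f ∧ ∀ x, f x ≠ x} ≃
      {σ : Equiv.Perm α // σ.cycleType = Multiset.replicate k 2} :=
    { toFun f := ⟨f.2.1.toPerm, (cycleType_eq_replicate_two_iff hα _).2 f.2⟩
      invFun σ := ⟨σ.1, (cycleType_eq_replicate_two_iff hα _).1 σ.2⟩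
      left_inv _ := rfl
      right_inv _ := by ext; rfl }
  have h := Equiv.Perm.card_of_cycleType_mul_eq α (Multiset.replicate k 2)
  have hk : ∏ m ∈ (Multiset.replicate k 2).toFinset, ((Multiset.replicate k 2).count m).factorial
      = k.factorial := by
    rcases Nat.eq_zero_or_pos k with rfl | hk
    · simp
    · rw [Multiset.toFinset_replicate, if_neg hk.ne']
      simp
  rw [hk, if_pos ⟨by simp [hα, mul_comm], fun a ha => (Multiset.eq_of_mem_replicate ha).ge⟩] at h
  rw [Nat.card_congr e, Nat.card_eq_fintype_card, Fintype.card_subtype]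
  simpa [hα, mul_comm] using h

/-- The number of `β`-valued functions constant on the pairs of a perfect matching of `2 * k`
points is `|β| ^ k`. -/
theorem card_invariant_functions {α β : Type*} [Fintype α] {k : ℕ}
    (hα : Fintype.card α = 2 * k) {f : α → α} (hf : Function.Involutive f)
    (hfix : ∀ x, f x ≠ x) :
    Nat.card {s : α → β // ∀ x, s (f x) = s x} = Nat.card β ^ k := by
  classical
  let r : Setoid α :=
    { r x y := y = x ∨ y = f x
      iseqv :=
        { refl _ := Or.inl rfl
          symm := by
            rintro x y (rfl | rfl)
            · exact Or.inl rfl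
            · exact Or.inr (hf x).symm
          trans := by
            rintro x y z (rfl | rfl) (rfl | rfl)
            · exact Or.inl rfl
            · exact Or.inr rfl
            · exact Or.inr rfl
            · exact Or.inl (hf x) } }
  have hfiber (q : Quotient r) : Nat.card {x // Quotient.mk r x = q} = 2 := by
    induction q using Quotient.inductionOn with
    | h y =>
      rw [Nat.card_eq_fintype_card, Fintype.card_subtype, ← Finset.card_pair (hfix y)]
      congr 1
      ext x
      have hxy : (Quotient.mk r x = Quotient.mk r y) ↔ (y = x ∨ y = f x) :=
        Quotient.eq (r := r)
      simp only [Finset.mem_filter, Finset.mem_univ, true_and, Finset.mem_insert,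
        Finset.mem_singleton, hxy]
      constructor
      · rintro (rfl | rfl)
        · exact Or.inr rfl
        · exact Or.inl (hf x).symm
      · rintro (rfl | rfl)
        · exact Or.inr (hf y).symm
        · exact Or.inl rfl
  have hcard : Nat.card (Quotient r) = k := by
    have h := Nat.card_congr (Equiv.sigmaFiberEquiv (Quotient.mk r))
    rw [Nat.card_sigma, Finset.sum_congr rfl fun q _ => hfiber q, Nat.card_eq_fintype_card (α := α),
      hα, Finset.sum_const, Finset.card_univ, ← Nat.card_eq_fintype_card, smul_eq_mul] at h
    omega
  have e : {s : α → β // ∀ x, s (f x) = s x} ≃ {s : α → β // r ≤ Setoid.ker s} :=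
    Equiv.subtypeEquivRight fun s => by
      constructor
      · rintro h x y (rfl | rfl)
        · rfl
        · exact (h x).symm
      · intro h x
        exact (h (show r.r x (f x) from Or.inr rfl)).symm
  rw [Nat.card_congr (e.trans (Setoid.liftEquiv r)), Nat.card_fun, hcard]

section TConfig

variable {n T : ℕ} {d : Fin n → ℕ}

namespace TConfig

@[ext]
theorem ext {c c' : TConfig n d T} (hp : c.pair = c'.pair) (hs : c.stamp = c'.stamp) :
    c = c' := by
  cases c
  cases c'
  cases hp
  cases hs
  rfl

/-- A configuration is a perfect matching together with a timestamp function constant on its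
pairs. -/
def equivSigma : TConfig n d T ≃
    (f : {f : TPoint n d → TPoint n d // Function.Involutive f ∧ ∀ x, f x ≠ x}) ×
      {s : TPoint n d → Fin T // ∀ x, s (f.1 x) = s x} where
  toFun c := ⟨⟨c.pair, c.invol, c.nofix⟩, c.stamp, c.compat⟩
  invFun p := ⟨p.1.1, p.2.1, p.1.2.1, p.1.2.2, p.2.2⟩
  left_inv _ := rfl
  right_inv _ := rfl

instance : Finite (TConfig n d T) := Finite.of_equiv _ equivSigma.symm

theorem card_mul {k : ℕ} (hk : ∑ i, d i = 2 * k) :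
    Nat.card (TConfig n d T) * (2 ^ k * k.factorial) = (2 * k).factorial * T ^ k := by
  classical
  have hα : Fintype.card (TPoint n d) = 2 * k := by simp [hk]
  rw [Nat.card_congr equivSigma, Nat.card_sigma,
    Finset.sum_congr rfl fun f _ => card_invariant_functions hα f.2.1 f.2.2, Finset.sum_const,
    Finset.card_univ, ← Nat.card_eq_fintype_card, Nat.card_fin, smul_eq_mul,
    ← card_fixedPointFree_involutions hα]
  ring

/-- The number of points of cell `i` matched with timestamp `t` to a point of cell `j`. -/
noncomputable def halfEdgeCount (c : TConfig n d T) (i j : Fin n) (t : Fin T) : ℕ :=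
  Nat.card {x : TPoint n d // x.1 = i ∧ (c.pair x).1 = j ∧ c.stamp x = t}

theorem halfEdgeCount_symm (c : TConfig n d T) (i j : Fin n) (t : Fin T) :
    c.halfEdgeCount i j t = c.halfEdgeCount j i t := by
  refine Nat.card_congr (c.invol.toPerm.subtypeEquiv fun x => ?_)
  simp only [Function.Involutive.coe_toPerm, c.invol x, c.compat x]
  tauto

theorem configGraph_of_ne (c : TConfig n d T) {i j : Fin n} (h : i ≠ j) (t : Fin T) :
    configGraph c i j t = c.halfEdgeCount i j t :=
  if_neg h

theorem configGraph_self_eq_zero_iff (c : TConfig n d T) (i : Fin n) (t : Fin T) :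
    configGraph c i i t = 0 ↔ c.halfEdgeCount i i t = 0 := by
  have h : configGraph c i i t = c.halfEdgeCount i i t / 2 := if_pos rfl
  rw [h]
  refine ⟨fun h0 => ?_, fun h0 => by simp [h0]⟩
  have hlt : c.halfEdgeCount i i t ≤ 1 := by omega
  have hsub : Subsingleton {x : TPoint n d // x.1 = i ∧ (c.pair x).1 = i ∧ c.stamp x = t} :=
    Finite.card_le_one_iff_subsingleton.1 hlt
  refine Nat.card_eq_zero.2 (Or.inl ⟨fun x => ?_⟩)
  have hx : c.pair x.1 = x.1 := congrArg Subtype.val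
    (hsub.elim ⟨c.pair x.1, x.2.2.1, by rw [c.invol]; exact x.2.1, by rw [c.compat]; exact x.2.2.2⟩
      x)
  exact c.nofix _ hx

theorem configGraph_eq_halfEdgeCount (c : TConfig n d T) (h : ∀ i t, configGraph c i i t = 0) :
    configGraph c = c.halfEdgeCount := by
  ext i j t
  rcases eq_or_ne i j with rfl | hij
  · rw [h, (c.configGraph_self_eq_zero_iff i t).1 (h i t)]
  · exact c.configGraph_of_ne hij t

theorem configGraph_eq_iff (c : TConfig n d T) {w : Fin n → Fin n → Fin T → ℕ}
    (hw : ∀ i t, w i i t = 0) : configGraph c = w ↔ c.halfEdgeCount = w := by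
  constructor
  · rintro rfl
    exact (c.configGraph_eq_halfEdgeCount hw).symm
  · rintro rfl
    exact c.configGraph_eq_halfEdgeCount fun i t => (c.configGraph_self_eq_zero_iff i t).2 (hw i t)

theorem sum_halfEdgeCount (c : TConfig n d T) (i : Fin n) :
    ∑ j, ∑ t, c.halfEdgeCount i j t = d i := by
  classical
  let g (a : Fin (d i)) : Fin n × Fin T := ((c.pair ⟨i, a⟩).1, c.stamp ⟨i, a⟩)
  have hcount (p : Fin n × Fin T) : c.halfEdgeCount i p.1 p.2 = Nat.card {a // g a = p} :=
    Nat.card_congr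
      { toFun x := ⟨x.2.1 ▸ x.1.2, by
          obtain ⟨⟨_, a⟩, rfl, h, h'⟩ := x
          exact Prod.ext h h'⟩
        invFun a := ⟨⟨i, a.1⟩, rfl, congrArg Prod.fst a.2, congrArg Prod.snd a.2⟩
        left_inv := by
          rintro ⟨⟨_, a⟩, rfl, h, h'⟩
          rfl
        right_inv _ := rfl }
  rw [← Fintype.sum_prod_type' (f := fun j t => c.halfEdgeCount i j t),
    Finset.sum_congr rfl fun p _ => hcount p, ← Nat.card_sigma,
    Nat.card_congr (Equiv.sigmaFiberEquiv g), Nat.card_fin]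

end TConfig

/-- The edges of a simple temporal graph at the node `i`, given by the other node and the
timestamp. -/
abbrev HalfEdgeAt (w : Fin n → Fin n → Fin T → ℕ) (i : Fin n) : Type :=
  {p : Fin n × Fin T // w i p.1 p.2 = 1}

namespace HalfEdge

variable {w : Fin n → Fin n → Fin T → ℕ}

theorem ext {h h' : Σ i, HalfEdgeAt w i} (h₁ : h.1 = h'.1) (h₂ : h.2.1 = h'.2.1) : h = h' := by
  obtain ⟨i, p, hp⟩ := h
  obtain ⟨i', p', hp'⟩ := h'
  obtain rfl : i = i' := h₁
  obtain rfl : p = p' := h₂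
  rfl

theorem card_halfEdgeAt (hsimple : ∀ i j t, w i j t ≤ 1) (hnoloop : ∀ i t, w i i t = 0)
    (i : Fin n) : Nat.card (HalfEdgeAt w i) = tmDegree w i := by
  classical
  rw [Nat.card_eq_fintype_card, Fintype.card_subtype, Finset.card_filter, tmDegree,
    ← Fintype.sum_prod_type' (f := fun j t => w i j t)]
  simp only [hnoloop, Finset.sum_const_zero, add_zero]
  refine Finset.sum_congr rfl fun p _ => ?_
  have := hsimple i p.1 p.2
  split_ifs <;> omega

/-- The other end of an edge. -/
def flip (hsymm : ∀ i j t, w i j t = w j i t) (h : Σ i, HalfEdgeAt w i) : Σ i, HalfEdgeAt w i :=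
  ⟨h.2.1.1, (h.1, h.2.1.2), (hsymm _ _ _).trans h.2.2⟩

theorem flip_flip (hsymm : ∀ i j t, w i j t = w j i t) (h : Σ i, HalfEdgeAt w i) :
    flip hsymm (flip hsymm h) = h :=
  rfl

theorem flip_ne (hsymm : ∀ i j t, w i j t = w j i t) (hnoloop : ∀ i t, w i i t = 0)
    (h : Σ i, HalfEdgeAt w i) : flip hsymm h ≠ h := by
  obtain ⟨i, ⟨j, t⟩, hp⟩ := h
  intro he
  obtain rfl : j = i := congrArg Sigma.fst he
  simp [hnoloop] at hp

end HalfEdge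

/-- The configuration obtained by labeling the edges at each node by the points of its cell. -/
def TConfig.ofLabeling {w : Fin n → Fin n → Fin T → ℕ} (hsymm : ∀ i j t, w i j t = w j i t)
    (hnoloop : ∀ i t, w i i t = 0) (e : ∀ i, Fin (d i) ≃ HalfEdgeAt w i) : TConfig n d T where
  pair x := (Equiv.sigmaCongrRight e).symm (HalfEdge.flip hsymm (Equiv.sigmaCongrRight e x))
  stamp x := (e x.1 x.2).1.2
  invol x := by simp only [Equiv.apply_symm_apply, HalfEdge.flip_flip, Equiv.symm_apply_apply]
  nofix x h := HalfEdge.flip_ne hsymm hnoloop _ ((Equiv.symm_apply_eq _).1 h)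
  compat x := congrArg (fun h => h.2.1.2)
    ((Equiv.sigmaCongrRight e).apply_symm_apply
      (HalfEdge.flip hsymm (Equiv.sigmaCongrRight e x)))

namespace TConfig

variable {w : Fin n → Fin n → Fin T → ℕ}

theorem halfEdgeCount_ofLabeling (hsymm : ∀ i j t, w i j t = w j i t)
    (hnoloop : ∀ i t, w i i t = 0) (hsimple : ∀ i j t, w i j t ≤ 1)
    (e : ∀ i, Fin (d i) ≃ HalfEdgeAt w i) :
    (ofLabeling hsymm hnoloop e).halfEdgeCount = w := by
  ext i j t
  have hle : (ofLabeling hsymm hnoloop e).halfEdgeCount i j t ≤ 1 := by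
    refine Finite.card_le_one_iff_subsingleton.2 ⟨?_⟩
    rintro ⟨⟨i₁, a⟩, hi, h₁, h₂⟩ ⟨⟨i₂, b⟩, hi', h₁', h₂'⟩
    obtain rfl : i₁ = i := hi
    obtain rfl : i₂ = i₁ := hi'
    obtain rfl : a = b :=
      (e _).injective (Subtype.ext (Prod.ext (h₁.trans h₁'.symm) (h₂.trans h₂'.symm)))
    rfl
  have hiff : (ofLabeling hsymm hnoloop e).halfEdgeCount i j t ≠ 0 ↔ w i j t = 1 := by
    constructor
    · intro h
      obtain ⟨⟨⟨⟨_, a⟩, rfl, rfl, rfl⟩⟩, -⟩ := Nat.card_ne_zero.1 h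
      exact (e _ a).2
    · intro h
      have ha := (e i).apply_symm_apply ⟨(j, t), h⟩
      exact Nat.card_ne_zero.2 ⟨⟨⟨i, (e i).symm ⟨(j, t), h⟩⟩, rfl,
        congrArg (fun p => p.1.1) ha, congrArg (fun p => p.1.2) ha⟩, inferInstance⟩
  have := hsimple i j t
  omega

theorem ofLabeling_injective (hsymm : ∀ i j t, w i j t = w j i t)
    (hnoloop : ∀ i t, w i i t = 0) :
    Function.Injective (ofLabeling (d := d) hsymm hnoloop) := by
  intro e e' h
  funext i
  ext a : 1
  refine Subtype.ext (Prod.ext ?_ ?_)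
  · exact congrArg (fun c : TConfig n d T => (c.pair ⟨i, a⟩).1) h
  · exact congrArg (fun c : TConfig n d T => c.stamp ⟨i, a⟩) h

theorem exists_ofLabeling_eq (hsymm : ∀ i j t, w i j t = w j i t)
    (hnoloop : ∀ i t, w i i t = 0) (hsimple : ∀ i j t, w i j t ≤ 1) (c : TConfig n d T)
    (hc : c.halfEdgeCount = w) : ∃ e, ofLabeling hsymm hnoloop e = c := by
  have hmem (x : TPoint n d) : w x.1 (c.pair x).1 (c.stamp x) = 1 := by
    refine le_antisymm (hsimple _ _ _) (Nat.one_le_iff_ne_zero.2 ?_)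
    rw [← hc]
    exact Nat.card_ne_zero.2 ⟨⟨x, rfl, rfl, rfl⟩, inferInstance⟩
  let f (i : Fin n) (a : Fin (d i)) : HalfEdgeAt w i :=
    ⟨((c.pair ⟨i, a⟩).1, c.stamp ⟨i, a⟩), hmem ⟨i, a⟩⟩
  have hf (i : Fin n) : Function.Bijective (f i) := by
    constructor
    · intro a b hab
      have h₁ : (c.pair ⟨i, a⟩).1 = (c.pair ⟨i, b⟩).1 := congrArg (fun p => p.1.1) hab
      have h₂ : c.stamp ⟨i, a⟩ = c.stamp ⟨i, b⟩ := congrArg (fun p => p.1.2) hab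
      have hle : c.halfEdgeCount i (c.pair ⟨i, b⟩).1 (c.stamp ⟨i, b⟩) ≤ 1 := by
        rw [hc]
        exact hsimple _ _ _
      have hsub := Finite.card_le_one_iff_subsingleton.1 hle
      have := congrArg Subtype.val (hsub.elim ⟨⟨i, a⟩, rfl, h₁, h₂⟩ ⟨⟨i, b⟩, rfl, rfl, rfl⟩)
      simpa using this
    · rintro ⟨⟨j, t⟩, hp⟩
      have hne : c.halfEdgeCount i j t ≠ 0 := by
        rw [hc, hp]
        exact one_ne_zero
      obtain ⟨⟨⟨⟨_, a⟩, rfl, rfl, rfl⟩⟩, -⟩ := Nat.card_ne_zero.1 hne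
      exact ⟨a, rfl⟩
  refine ⟨fun i => Equiv.ofBijective (f i) (hf i), ?_⟩
  ext1
  · funext x
    refine (Equiv.symm_apply_eq _).2 (HalfEdge.ext rfl (Prod.ext ?_ ?_))
    · exact (congrArg Sigma.fst (c.invol x)).symm
    · exact (c.compat x).symm
  · rfl

/-- Every simple temporal graph corresponds to exactly `∏ i, (d i)!` configurations. -/
theorem card_configGraph_eq (hsymm : ∀ i j t, w i j t = w j i t) (hdeg : ∀ i, tmDegree w i = d i)
    (hnoloop : ∀ i t, w i i t = 0) (hsimple : ∀ i j t, w i j t ≤ 1) :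
    Nat.card {c : TConfig n d T // configGraph c = w} = ∏ i, (d i).factorial := by
  classical
  let φ (e : ∀ i, Fin (d i) ≃ HalfEdgeAt w i) : {c : TConfig n d T // configGraph c = w} :=
    ⟨ofLabeling hsymm hnoloop e, (configGraph_eq_iff _ hnoloop).2
      (halfEdgeCount_ofLabeling hsymm hnoloop hsimple e)⟩
  have hφ : Function.Bijective φ := by
    refine ⟨fun e e' h => ofLabeling_injective hsymm hnoloop (congrArg Subtype.val h), ?_⟩
    rintro ⟨c, hc⟩
    obtain ⟨e, he⟩ :=
      exists_ofLabeling_eq hsymm hnoloop hsimple c ((configGraph_eq_iff c hnoloop).1 hc)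
    exact ⟨e, Subtype.ext he⟩
  rw [← Nat.card_eq_of_bijective φ hφ, Nat.card_pi]
  refine Finset.prod_congr rfl fun i _ => ?_
  have hcard : Fintype.card (Fin (d i)) = Fintype.card (HalfEdgeAt w i) := by
    rw [← Nat.card_eq_fintype_card (α := HalfEdgeAt w i),
      HalfEdge.card_halfEdgeAt hsimple hnoloop, hdeg, Fintype.card_fin]
  rw [Nat.card_eq_fintype_card, Fintype.card_equiv (Fintype.equivOfCardEq hcard), Fintype.card_fin]

/-- The number of configurations whose temporal multigraph is simple. -/
theorem card_simple :
    Nat.card {c : TConfig n d T //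
        (∀ i t, configGraph c i i t = 0) ∧ ∀ i j t, configGraph c i j t ≤ 1} =
      Nat.card {w : Fin n → Fin n → Fin T → ℕ //
        (∀ i j t, w i j t = w j i t) ∧ (∀ i, tmDegree w i = d i) ∧
        (∀ i t, w i i t = 0) ∧ ∀ i j t, w i j t ≤ 1} * ∏ i, (d i).factorial := by
  classical
  set G := {w : Fin n → Fin n → Fin T → ℕ //
    (∀ i j t, w i j t = w j i t) ∧ (∀ i, tmDegree w i = d i) ∧
    (∀ i t, w i i t = 0) ∧ ∀ i j t, w i j t ≤ 1}
  have : Finite G := by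
    refine Finite.of_injective
      (fun (w : G) i j t => (⟨w.1 i j t, Nat.lt_succ_of_le (w.2.2.2.2 i j t)⟩ : Fin 2)) ?_
    intro w w' h
    refine Subtype.ext ?_
    funext i j t
    exact congrArg Fin.val (congrFun (congrFun (congrFun h i) j) t)
  have := Fintype.ofFinite G
  let g (c : {c : TConfig n d T //
      (∀ i t, configGraph c i i t = 0) ∧ ∀ i j t, configGraph c i j t ≤ 1}) : G :=
    ⟨configGraph c.1, by
      have h := c.1.configGraph_eq_halfEdgeCount c.2.1
      refine ⟨fun i j t => ?_, fun i => ?_, c.2⟩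
      · rw [h, halfEdgeCount_symm]
      · simp only [tmDegree, c.2.1, Finset.sum_const_zero, add_zero]
        rw [h, sum_halfEdgeCount]⟩
  have hfiber (w : G) : Nat.card {c // g c = w} = ∏ i, (d i).factorial := by
    rw [← card_configGraph_eq w.2.1 w.2.2.1 w.2.2.2.1 w.2.2.2.2]
    exact Nat.card_congr
      { toFun c := ⟨c.1.1, congrArg Subtype.val c.2⟩
        invFun c := ⟨⟨c.1, by rw [c.2]; exact w.2.2.2⟩, Subtype.ext c.2⟩
        left_inv _ := rfl
        right_inv _ := rfl }
  rw [← Nat.card_congr (Equiv.sigmaFiberEquiv g), Nat.card_sigma,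
    Finset.sum_congr rfl fun w _ => hfiber w, Finset.sum_const, Finset.card_univ,
    ← Nat.card_eq_fintype_card, smul_eq_mul]

end TConfig

end TConfig

/-- For every simple temporal graph `w` matching `(d, T)`, the probability that the
temporal multigraph corresponding to a uniformly random temporal configuration equals `w`
is exactly `(∏ i, (d i)!) · 2^{M/2} · (M/2)! / (M! · T^{M/2})`.  In particular, conditioned
on the corresponding temporal multigraph being simple, it is uniformly distributed on the
set `G(D)` of simple temporal graphs matching `(d, T)`: the conditional probability of each
such `w` equals `1 / |G(D)|`. -/
theorem stmt16 (n T : ℕ) (d : Fin n → ℕ) (M : ℕ) (hM : M = ∑ i, d i)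
    (hEven : Even M) (hT : 1 ≤ T)
    (w : Fin n → Fin n → Fin T → ℕ)
    (hsymm : ∀ i j t, w i j t = w j i t)
    (hdeg : ∀ i, tmDegree w i = d i)
    (hnoloop : ∀ i t, w i i t = 0)
    (hsimple : ∀ i j t, w i j t ≤ 1) :
    (Nat.card {c : TConfig n d T // ∀ i j t, configGraph c i j t = w i j t} : ℝ) /
        Nat.card (TConfig n d T) =
      (∏ i, ((d i).factorial : ℝ)) * 2 ^ (M / 2) * ((M / 2).factorial : ℝ) /
        ((M.factorial : ℝ) * (T : ℝ) ^ (M / 2)) ∧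
    (Nat.card {c : TConfig n d T // ∀ i j t, configGraph c i j t = w i j t} : ℝ) /
        Nat.card {c : TConfig n d T //
          (∀ i t, configGraph c i i t = 0) ∧ ∀ i j t, configGraph c i j t ≤ 1} =
      1 / (Nat.card {w' : Fin n → Fin n → Fin T → ℕ //
          (∀ i j t, w' i j t = w' j i t) ∧ (∀ i, tmDegree w' i = d i) ∧
          (∀ i t, w' i i t = 0) ∧ ∀ i j t, w' i j t ≤ 1} : ℝ) := by
  have hK := TConfig.card_configGraph_eq hsymm hdeg hnoloop hsimple
  simp only [funext_iff] at hK
  have hpos : (∏ i, ((d i).factorial : ℝ)) ≠ 0 :=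
    Finset.prod_ne_zero_iff.2 fun i _ => Nat.cast_ne_zero.2 (Nat.factorial_ne_zero _)
  constructor
  · obtain ⟨k, rfl⟩ := hEven.two_dvd
    have hT' : (T : ℝ) ≠ 0 := Nat.cast_ne_zero.2 (by omega)
    have hfact : (((2 * k).factorial : ℕ) : ℝ) ≠ 0 := Nat.cast_ne_zero.2 (Nat.factorial_ne_zero _)
    have htotal := congrArg (Nat.cast (R := ℝ)) (TConfig.card_mul (T := T) hM.symm)
    push_cast at htotal
    have hne : (Nat.card (TConfig n d T) : ℝ) ≠ 0 := by
      intro h0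
      rw [h0, zero_mul] at htotal
      exact mul_ne_zero hfact (pow_ne_zero k hT') htotal.symm
    rw [hK, Nat.mul_div_cancel_left k two_pos, div_eq_div_iff hne (by positivity), ← htotal]
    push_cast
    ring
  · rw [hK, TConfig.card_simple]
    push_cast
    rw [mul_comm, div_mul_cancel_left₀ hpos, one_div]
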